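/- arXiv:0708.2509 — 7 statements merged into one kernel-verified Lean document; each statement's English description precedes it below -/
import Mathlib

section
/- The subset R generates the group G; that is, the subgroup of G generated by R is all of G. Consequently every element of G admits a presentation as a finite sum of elements of R. -/
/-- The free abelian group with basis `{X m} ∪ {Y m}`, `m ∈ ℤ`. -/
abbrev G : Type := (ℤ ⊕ ℤ) →₀ ℤ

/-- The basis element `X m`. -/
noncomputable def X (m : ℤ) : G := Finsupp.single (Sum.inl m) 1

/-- The basis element `Y m`. -/
noncomputable def Y (m : ℤ) : G := Finsupp.single (Sum.inr m) 1

/-- The set `R ⊆ G` of allowed changes: `X 0`, `Y 0`, `X m + Y m`, `X m + Y (m+1)`,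
`X m - X (m+1)`, `Y m - Y (m+1)`, and their negatives. -/
def R : Set G :=
  {v | v = X 0 ∨ v = Y 0 ∨
    (∃ m, v = X m + Y m) ∨ (∃ m, v = X m + Y (m + 1)) ∨
    (∃ m, v = X m - X (m + 1)) ∨ (∃ m, v = Y m - Y (m + 1)) ∨
    v = -X 0 ∨ v = -Y 0 ∨
    (∃ m, v = -(X m + Y m)) ∨ (∃ m, v = -(X m + Y (m + 1))) ∨
    (∃ m, v = -(X m - X (m + 1))) ∨ (∃ m, v = -(Y m - Y (m + 1)))}

/-- The element `v_n = (n+1)·X 0 + n·Y 1 − (n+1)·Y 0 − n·X (−1)`. -/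
noncomputable def v (n : ℤ) : G := (n + 1) • X 0 + n • Y 1 - (n + 1) • Y 0 - n • X (-1)

/-- A subgroup containing `f 0` and all differences `f m - f (m + 1)` contains every `f m`. -/
theorem mem_of_zero_of_sub_succ {A : Type*} [AddCommGroup A] (H : AddSubgroup A) (f : ℤ → A)
    (h_zero : f 0 ∈ H) (h_sub : ∀ m, f m - f (m + 1) ∈ H) (m : ℤ) : f m ∈ H := by
  induction m using Int.induction_on with
  | zero => exact h_zero
  | succ k ih => simpa using H.sub_mem ih (h_sub k)
  | pred k ih =>
    have h := h_sub (-k - 1)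
    rw [sub_add_cancel] at h
    simpa using H.add_mem h ih

theorem neg_mem_R {r : G} (hr : r ∈ R) : -r ∈ R := by
  rcases hr with h | h | ⟨m, h⟩ | ⟨m, h⟩ | ⟨m, h⟩ | ⟨m, h⟩ | h | h | ⟨m, h⟩ | ⟨m, h⟩ | ⟨m, h⟩ |
    ⟨m, h⟩ <;> subst h <;> simp only [R, Set.mem_ofPred_eq, neg_neg] <;> tauto

theorem X_mem_closure_R (m : ℤ) : X m ∈ AddSubgroup.closure R :=
  mem_of_zero_of_sub_succ _ X (AddSubgroup.subset_closure (by simp [R]))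
    (fun k => AddSubgroup.subset_closure
      (.inr <| .inr <| .inr <| .inr <| .inl ⟨k, rfl⟩)) m

theorem Y_mem_closure_R (m : ℤ) : Y m ∈ AddSubgroup.closure R :=
  mem_of_zero_of_sub_succ _ Y (AddSubgroup.subset_closure (by simp [R]))
    (fun k => AddSubgroup.subset_closure
      (.inr <| .inr <| .inr <| .inr <| .inr <| .inl ⟨k, rfl⟩)) m

theorem closure_R : AddSubgroup.closure R = ⊤ := by
  refine (AddSubgroup.eq_top_iff' _).2 fun w => ?_
  rw [← w.sum_single]
  refine AddSubgroup.sum_mem _ fun i _ => ?_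
  rw [← mul_one (w i), ← smul_eq_mul, ← Finsupp.smul_single]
  refine AddSubgroup.zsmul_mem _ ?_ _
  cases i with
  | inl m => exact X_mem_closure_R m
  | inr m => exact Y_mem_closure_R m

/-- `R` generates `G`; consequently every element of `G` is a finite sum of elements of `R`. -/
theorem R_generates :
    AddSubgroup.closure R = (⊤ : AddSubgroup G) ∧
      ∀ w : G, ∃ L : List G, (∀ r ∈ L, r ∈ R) ∧ L.sum = w := by
  refine ⟨closure_R, fun w => ?_⟩
  have hw : w ∈ (AddSubgroup.closure R).toAddSubmonoid := closure_R ▸ AddSubgroup.mem_top w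
  rw [AddSubgroup.closure_toAddSubmonoid] at hw
  obtain ⟨L, hL, h_sum⟩ := AddSubmonoid.exists_list_of_mem_closure hw
  exact ⟨L, fun r hr => (hL r hr).elim id fun h => neg_neg r ▸ neg_mem_R h, h_sum⟩
end

section
/- For every integer n ≥ 1, every presentation of v_n as a sum of elements of R has length at least 2n+2; that is, if r_1, …, r_k ∈ R and r_1 + ⋯ + r_k = v_n, then k ≥ 2n+2. -/
/-- The coefficient of `X 0` minus that of `Y 0` is at most `1` on `R`. -/
lemma coeff_sub_le_one {r : G} (hr : r ∈ R) : r (Sum.inl 0) - r (Sum.inr 0) ≤ 1 := by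
  rcases hr with rfl | rfl | ⟨m, rfl⟩ | ⟨m, rfl⟩ | ⟨m, rfl⟩ | ⟨m, rfl⟩ |
    rfl | rfl | ⟨m, rfl⟩ | ⟨m, rfl⟩ | ⟨m, rfl⟩ | ⟨m, rfl⟩ <;>
  simp [X, Y, Finsupp.single_apply] <;> split_ifs <;> omega

lemma coeff_sub_sum_le_length (L : List G) (hL : ∀ r ∈ L, r ∈ R) :
    L.sum (Sum.inl 0) - L.sum (Sum.inr 0) ≤ (L.length : ℤ) := by
  induction L with
  | nil => simp
  | cons r L ih =>
    have hr := coeff_sub_le_one (hL r (by simp))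
    have hs := ih fun s hs => hL s (by simp [hs])
    simp only [List.sum_cons, Finsupp.add_apply, List.length_cons, Nat.cast_add, Nat.cast_one]
    linarith

/-- For every `n ≥ 1`, every presentation of `v n` as a sum of elements of `R`
has length at least `2n + 2`. -/
theorem presentation_length_lower_bound (n : ℤ) (hn : 1 ≤ n)
    (L : List G) (hL : ∀ r ∈ L, r ∈ R) (hsum : L.sum = v n) :
    2 * n + 2 ≤ (L.length : ℤ) := by
  have h := coeff_sub_sum_le_length L hL
  rw [hsum] at h
  simp [v, X, Y] at h
  linarith
end

section
/- For every integer n ≥ 1, the R-length of v_n is exactly 2n+2; that is, the minimal length of a presentation of v_n as a sum of elements of R equals 2n+2. -/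
/-- The coordinate difference `w ↦ w(X 0) - w(Y 0)`, which is bounded by `1` on `R`. -/
noncomputable def zeroDiff : G →+ ℤ :=
  Finsupp.applyAddHom (Sum.inl 0) - Finsupp.applyAddHom (Sum.inr 0)

theorem zeroDiff_X (m : ℤ) : zeroDiff (X m) = if m = 0 then 1 else 0 := by
  simp [zeroDiff, X, Finsupp.single_apply]

theorem zeroDiff_Y (m : ℤ) : zeroDiff (Y m) = if m = 0 then -1 else 0 := by
  by_cases h : m = 0 <;> simp [zeroDiff, Y, h]

theorem zeroDiff_le_one {r : G} (hr : r ∈ R) : zeroDiff r ≤ 1 := by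
  rcases hr with rfl | rfl | ⟨m, rfl⟩ | ⟨m, rfl⟩ | ⟨m, rfl⟩ | ⟨m, rfl⟩ | rfl | rfl |
    ⟨m, rfl⟩ | ⟨m, rfl⟩ | ⟨m, rfl⟩ | ⟨m, rfl⟩ <;>
  simp only [map_add, map_sub, map_neg, zeroDiff_X, zeroDiff_Y] <;> split_ifs <;> omega

theorem zeroDiff_v (n : ℤ) : zeroDiff (v n) = 2 * n + 2 := by
  simp only [v, map_add, map_sub, map_zsmul, zeroDiff_X, zeroDiff_Y]
  norm_num
  ring

/-- For every `n ≥ 1`, the `R`-length of `v n` (the minimal length of a presentation of `v n`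
as a sum of elements of `R`) is exactly `2n + 2`. -/
theorem R_length_eq (n : ℤ) (hn : 1 ≤ n) :
    IsLeast {k : ℤ | ∃ L : List G, (∀ r ∈ L, r ∈ R) ∧ L.sum = v n ∧ (L.length : ℤ) = k}
      (2 * n + 2) := by
  constructor
  · lift n to ℕ using by omega
    refine ⟨List.replicate n (-(X (-1) - X (-1 + 1))) ++ List.replicate n (-(Y 0 - Y (0 + 1))) ++
      [X 0, -Y 0], ?_, ?_, ?_⟩
    · intro r hr
      simp only [List.mem_append, List.mem_replicate, List.mem_cons, List.not_mem_nil,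
        or_false] at hr
      rcases hr with (⟨-, rfl⟩ | ⟨-, rfl⟩) | rfl | rfl <;> simp only [R, Set.mem_ofPred_eq]
      · exact .inr <| .inr <| .inr <| .inr <| .inr <| .inr <| .inr <| .inr <| .inr <| .inr <|
          .inl ⟨-1, rfl⟩
      · exact .inr <| .inr <| .inr <| .inr <| .inr <| .inr <| .inr <| .inr <| .inr <| .inr <|
          .inr ⟨0, rfl⟩
      · simp
      · simp
    · simp only [List.sum_append, List.sum_replicate, List.sum_cons, List.sum_nil, v,
        neg_add_cancel, zero_add]
      module
    · simp only [List.length_append, List.length_replicate, List.length_cons, List.length_nil]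
      push_cast
      ring
  · rintro k ⟨L, hL, hsum, rfl⟩
    have h := List.sum_le_card_nsmul (L.map zeroDiff) 1 (by
      simpa using fun r hr ↦ zeroDiff_le_one (hL r hr))
    rw [← map_list_sum, hsum, zeroDiff_v] at h
    simpa using h
end

section
/- For every integer n ≥ 1, in any presentation of v_n as a sum of exactly 2n+2 elements of R, precisely two of the terms belong to the set {X_0, −Y_0}, and each of the remaining 2n terms belongs to the four-element set Q = {X_0 + Y_1, −(X_{−1} + Y_0), X_0 − X_{−1}, Y_1 − Y_0}. -/
/-- The four-element set `Q = {X 0 + Y 1, −(X (−1) + Y 0), X 0 − X (−1), Y 1 − Y 0}`. -/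
def Q : Set G := {X 0 + Y 1, -(X (-1) + Y 0), X 0 - X (-1), Y 1 - Y 0}

theorem List.sum_map_le_length_mul {α : Type*} (f : α → ℤ) (c : ℤ) (L : List α)
    (h : ∀ a ∈ L, f a ≤ c) : (L.map f).sum ≤ L.length * c := by
  simpa using List.sum_le_card_nsmul (L.map f) c (by simpa using h)

theorem List.forall_eq_of_sum_map_eq_length_mul {α : Type*} (f : α → ℤ) (c : ℤ) (L : List α)
    (h : ∀ a ∈ L, f a ≤ c) (hs : (L.map f).sum = L.length * c) : ∀ a ∈ L, f a = c := by
  induction L with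
  | nil => simp
  | cons b L ih =>
    have hL : ∀ a ∈ L, f a ≤ c := fun a ha => h a (List.mem_cons_of_mem b ha)
    have hle := List.sum_map_le_length_mul f c L hL
    have hb := h b List.mem_cons_self
    simp only [List.map_cons, List.sum_cons, List.length_cons, Nat.cast_add, Nat.cast_one] at hs
    have hfb : f b = c := by linarith
    have htail := ih hL (by linarith)
    intro a ha
    rcases List.mem_cons.mp ha with rfl | ha
    exacts [hfb, htail a ha]

theorem List.sum_map_eq_countP {α : Type*} (f : α → ℤ) (p : α → Bool) (L : List α)
    (h : ∀ a ∈ L, f a = if p a then 1 else 0) : (L.map f).sum = L.countP p := by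
  rw [List.map_congr_left h]
  induction L with
  | nil => simp
  | cons b L ih =>
    have := ih fun a ha => h a (List.mem_cons_of_mem b ha)
    by_cases hb : p b <;> simp_all [add_comm]

/-- After the substitution `Z m = -Y m`, the elements of `R` are differences of two vertices among
`X m`, `Z m` and `0`. This additive potential has value `2` at the vertices `X 0`, `Z 0`, value `0`
at `X (-1)`, `Z 1`, and value `1` at every other `X m`, `Z m`. -/
noncomputable def potential : G →ₗ[ℤ] ℤ :=
  Finsupp.linearCombination ℤ <| Sum.elim
    (fun m => if m = 0 then 2 else if m = -1 then 0 else 1)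
    (fun m => if m = 0 then -2 else if m = 1 then 0 else -1)

/-- The sum of the `X`-coordinates minus the sum of the `Y`-coordinates. -/
noncomputable def charge : G →ₗ[ℤ] ℤ :=
  Finsupp.linearCombination ℤ <| Sum.elim (fun _ => 1) (fun _ => -1)

theorem potential_X (m : ℤ) :
    potential (X m) = if m = 0 then 2 else if m = -1 then 0 else 1 := by
  simp [potential, X]

theorem potential_Y (m : ℤ) :
    potential (Y m) = if m = 0 then -2 else if m = 1 then 0 else -1 := by
  simp [potential, Y]

theorem charge_X (m : ℤ) : charge (X m) = 1 := by
  simp [charge, X]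

theorem charge_Y (m : ℤ) : charge (Y m) = -1 := by
  simp [charge, Y]

theorem potential_v (n : ℤ) : potential (v n) = 4 * n + 4 := by
  simp only [v, map_add, map_sub, map_smul, potential_X, potential_Y, smul_eq_mul]
  norm_num
  ring

theorem charge_v (n : ℤ) : charge (v n) = 2 := by
  simp only [v, map_add, map_sub, map_smul, charge_X, charge_Y, smul_eq_mul]
  ring

theorem potential_le_of_mem_R {r : G} (hr : r ∈ R) : potential r ≤ 2 := by
  rcases hr with rfl | rfl | ⟨m, rfl⟩ | ⟨m, rfl⟩ | ⟨m, rfl⟩ | ⟨m, rfl⟩ | rfl | rfl | ⟨m, rfl⟩ |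
    ⟨m, rfl⟩ | ⟨m, rfl⟩ | ⟨m, rfl⟩ <;>
  simp only [map_add, map_sub, map_neg, potential_X, potential_Y] <;> split_ifs <;> omega

theorem mem_of_mem_R_of_potential_eq {r : G} (hr : r ∈ R) (h : potential r = 2) :
    (r = X 0 ∨ r = -Y 0) ∨ r ∈ Q := by
  rcases hr with rfl | rfl | ⟨m, rfl⟩ | ⟨m, rfl⟩ | ⟨m, rfl⟩ | ⟨m, rfl⟩ | rfl | rfl | ⟨m, rfl⟩ |
    ⟨m, rfl⟩ | ⟨m, rfl⟩ | ⟨m, rfl⟩ <;>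
  simp only [map_add, map_sub, map_neg, potential_X, potential_Y] at h
  · simp
  · simp at h
  · split_ifs at h <;> omega
  · obtain rfl : m = 0 := by split_ifs at h <;> omega
    simp [Q]
  · split_ifs at h <;> omega
  · split_ifs at h <;> omega
  · simp at h
  · simp
  · split_ifs at h <;> omega
  · obtain rfl : m = -1 := by split_ifs at h <;> omega
    simp [Q]
  · obtain rfl : m = -1 := by split_ifs at h <;> omega
    simp [Q]
  · obtain rfl : m = 0 := by split_ifs at h <;> omega
    simp [Q]

theorem charge_eq_one {r : G} (hr : r = X 0 ∨ r = -Y 0) : charge r = 1 := by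
  rcases hr with rfl | rfl <;> simp [charge_X, charge_Y]

theorem charge_eq_zero_of_mem_Q {r : G} (hr : r ∈ Q) : charge r = 0 := by
  rcases hr with rfl | rfl | rfl | rfl <;> simp [charge_X, charge_Y]


/-- For every `n ≥ 1`, in any presentation of `v n` as a sum of exactly `2n + 2` elements of `R`,
precisely two of the terms belong to `{X 0, −Y 0}`, and all remaining terms belong to `Q`. -/
theorem minimal_presentation_structure (n : ℤ) (hn : 1 ≤ n)
    (L : List G) (hL : ∀ r ∈ L, r ∈ R) (hsum : L.sum = v n)
    (hlen : (L.length : ℤ) = 2 * n + 2) :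
    L.countP (fun r => decide (r = X 0 ∨ r = -Y 0)) = 2 ∧
      ∀ r ∈ L, ¬(r = X 0 ∨ r = -Y 0) → r ∈ Q := by
  have hmem : ∀ r ∈ L, (r = X 0 ∨ r = -Y 0) ∨ r ∈ Q := by
    have hpot := L.forall_eq_of_sum_map_eq_length_mul potential 2
      (fun r hr => potential_le_of_mem_R (hL r hr))
      (by rw [← map_list_sum, hsum, potential_v, hlen]; ring)
    exact fun r hr => mem_of_mem_R_of_potential_eq (hL r hr) (hpot r hr)
  refine ⟨?_, fun r hr hne => (hmem r hr).resolve_left hne⟩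
  have hcount := L.sum_map_eq_countP charge (fun r => decide (r = X 0 ∨ r = -Y 0)) fun r hr => by
    by_cases h : r = X 0 ∨ r = -Y 0
    · rw [charge_eq_one h, if_pos (decide_eq_true h)]
    · rw [charge_eq_zero_of_mem_Q ((hmem r hr).resolve_left h), if_neg (by simpa using h)]
  rw [← map_list_sum, hsum, charge_v] at hcount
  exact_mod_cast hcount.symm
end

section
/- For every integer n ≥ 1, in any presentation of v_n as a sum of exactly 2n+2 elements of R, no term is of the form X_m + Y_m or −(X_m + Y_m) for any m ∈ ℤ. (In the paper's language: no unmatched RII move may appear in a minimal sequence of Reidemeister moves from D_n to E_n.) -/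
/-- The coefficient of `X 0` minus the coefficient of `Y 0`. -/
noncomputable def coeffDiff : G →+ ℤ :=
  Finsupp.applyAddHom (Sum.inl 0) - Finsupp.applyAddHom (Sum.inr 0)

lemma coeffDiff_X (m : ℤ) : coeffDiff (X m) = if m = 0 then 1 else 0 := by
  simp [coeffDiff, X, Finsupp.single_apply]

lemma coeffDiff_Y (m : ℤ) : coeffDiff (Y m) = if m = 0 then -1 else 0 := by
  by_cases h : m = 0 <;> simp [coeffDiff, Y, h]

lemma coeffDiff_X_add_Y (m : ℤ) : coeffDiff (X m + Y m) = 0 := by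
  rw [map_add, coeffDiff_X, coeffDiff_Y]
  split_ifs <;> norm_num

lemma coeffDiff_le_one {r : G} (hr : r ∈ R) : coeffDiff r ≤ 1 := by
  rcases hr with rfl | rfl | ⟨m, rfl⟩ | ⟨m, rfl⟩ | ⟨m, rfl⟩ | ⟨m, rfl⟩ | rfl | rfl | ⟨m, rfl⟩ |
    ⟨m, rfl⟩ | ⟨m, rfl⟩ | ⟨m, rfl⟩ <;>
  simp only [map_add, map_sub, map_neg, coeffDiff_X, coeffDiff_Y] <;>
  split_ifs <;> omega

lemma coeffDiff_v (n : ℤ) : coeffDiff (v n) = 2 * n + 2 := by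
  simp only [v, map_add, map_sub, map_zsmul, coeffDiff_X, coeffDiff_Y]
  norm_num
  ring

/-- If an additive map is at most `1` on every term of a list, and its value on the sum is the
length of the list, then it equals `1` on every term. -/
lemma eq_one_of_map_sum_eq_length {A : Type*} [AddMonoid A] (f : A →+ ℤ) (L : List A)
    (hle : ∀ r ∈ L, f r ≤ 1) (hsum : f L.sum = L.length) : ∀ r ∈ L, f r = 1 := by
  have bound (L : List A) (hle : ∀ r ∈ L, f r ≤ 1) : f L.sum ≤ L.length := by
    simpa [map_list_sum] using List.sum_le_card_nsmul (L.map f) 1 (by simpa using hle)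
  induction L with
  | nil => simp
  | cons a L ih =>
    rw [List.forall_mem_cons] at hle ⊢
    have hL := bound L hle.2
    rw [List.sum_cons, map_add, List.length_cons] at hsum
    push_cast at hsum
    exact ⟨by linarith [hle.1], ih hle.2 (by linarith [hle.1])⟩

/-- For every `n ≥ 1`, in any presentation of `v n` as a sum of exactly `2n + 2` elements of `R`,
no term is of the form `X m + Y m` or `−(X m + Y m)` (no unmatched RII move). -/
theorem no_unmatched_RII (n : ℤ) (hn : 1 ≤ n)
    (L : List G) (hL : ∀ r ∈ L, r ∈ R) (hsum : L.sum = v n)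
    (hlen : (L.length : ℤ) = 2 * n + 2) :
    ∀ r ∈ L, ∀ m : ℤ, r ≠ X m + Y m ∧ r ≠ -(X m + Y m) := by
  have key := eq_one_of_map_sum_eq_length coeffDiff L (fun r hr => coeffDiff_le_one (hL r hr))
    (by rw [hsum, coeffDiff_v, hlen])
  intro r hr m
  constructor <;> rintro rfl <;> simpa [-map_add, -neg_add_rev, coeffDiff_X_add_Y] using key _ hr
end

section
/- For every element r ∈ R, |e(r)| ≤ 2; moreover e(r) = 2 if and only if r belongs to the four-element set Q = {X_0 + Y_1, −(X_{−1} + Y_0), X_0 − X_{−1}, Y_1 − Y_0}, where e is the group homomorphism G → ℤ determined by e(X_0) = e(Y_1) = 1, e(X_{−1}) = e(Y_0) = −1, and e(X_m) = e(Y_m) = 0 on all other basis elements. -/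
/-- Coefficients of `e` on the basis: `e(X 0) = e(Y 1) = 1`, `e(X (−1)) = e(Y 0) = −1`,
and `0` on all other basis elements. -/
def eCoeff : ℤ ⊕ ℤ → ℤ
  | Sum.inl m => if m = 0 then 1 else if m = -1 then -1 else 0
  | Sum.inr m => if m = 1 then 1 else if m = 0 then -1 else 0

/-- The group homomorphism `e : G → ℤ` determined by `e(X 0) = e(Y 1) = 1`,
`e(X (−1)) = e(Y 0) = −1`, and `e = 0` on all other basis elements. -/
noncomputable def e : G →+ ℤ := Finsupp.liftAddHom fun i => zmultiplesHom ℤ (eCoeff i)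

lemma e_X (m : ℤ) : e (X m) = if m = 0 then 1 else if m = -1 then -1 else 0 := by
  simp [e, X, eCoeff]

lemma e_Y (m : ℤ) : e (Y m) = if m = 1 then 1 else if m = 0 then -1 else 0 := by
  simp [e, Y, eCoeff]

lemma e_eq_two_of_mem_Q {r : G} (hr : r ∈ Q) : e r = 2 := by
  rcases hr with rfl | rfl | rfl | rfl <;> simp [e_X, e_Y]

lemma abs_e_le_two {r : G} (hr : r ∈ R) : |e r| ≤ 2 := by
  rw [abs_le]
  rcases hr with rfl | rfl | ⟨m, rfl⟩ | ⟨m, rfl⟩ | ⟨m, rfl⟩ | ⟨m, rfl⟩ |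
      rfl | rfl | ⟨m, rfl⟩ | ⟨m, rfl⟩ | ⟨m, rfl⟩ | ⟨m, rfl⟩ <;>
    simp only [map_neg, map_add, map_sub, e_X, e_Y] <;> split_ifs <;> omega

lemma mem_Q_of_e_eq_two {r : G} (hr : r ∈ R) (h : e r = 2) : r ∈ Q := by
  rcases hr with rfl | rfl | ⟨m, rfl⟩ | ⟨m, rfl⟩ | ⟨m, rfl⟩ | ⟨m, rfl⟩ |
      rfl | rfl | ⟨m, rfl⟩ | ⟨m, rfl⟩ | ⟨m, rfl⟩ | ⟨m, rfl⟩ <;>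
    simp only [map_neg, map_add, map_sub, e_X, e_Y] at h
  case inr.inr.inr.inl =>
    obtain rfl : m = 0 := by split_ifs at h <;> omega
    simp [Q]
  case inr.inr.inr.inr.inr.inr.inr.inr.inr.inl =>
    obtain rfl : m = -1 := by split_ifs at h <;> omega
    simp [Q]
  case inr.inr.inr.inr.inr.inr.inr.inr.inr.inr.inl =>
    obtain rfl : m = -1 := by split_ifs at h <;> omega
    simp [Q]
  case inr.inr.inr.inr.inr.inr.inr.inr.inr.inr.inr =>
    obtain rfl : m = 0 := by split_ifs at h <;> omega
    simp [Q]
  all_goals split_ifs at h <;> omega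

/-- For every `r ∈ R`, `|e r| ≤ 2`; moreover `e r = 2` iff `r ∈ Q`. -/
theorem e_on_R : ∀ r ∈ R, |e r| ≤ 2 ∧ (e r = 2 ↔ r ∈ Q) :=
  fun _ hr => ⟨abs_e_le_two hr, mem_Q_of_e_eq_two hr, e_eq_two_of_mem_Q⟩
end

section
/- For every integer n ≥ 1, every presentation of v_n as a sum of elements of R (of any length) contains at least two terms belonging to the set {X_0, −Y_0}; that is, if r_1, …, r_k ∈ R and r_1 + ⋯ + r_k = v_n, then the number of indices i with r_i = X_0 or r_i = −Y_0 is at least 2. -/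
/-- The homomorphism `G → ℤ` sending every `X m` to `1` and every `Y m` to `-1`. -/
noncomputable def signedDegree : G →ₗ[ℤ] ℤ :=
  Finsupp.linearCombination ℤ (Sum.elim (fun _ => 1) (fun _ => -1))

@[simp] lemma signedDegree_X (m : ℤ) : signedDegree (X m) = 1 := by
  simp [signedDegree, X]

@[simp] lemma signedDegree_Y (m : ℤ) : signedDegree (Y m) = -1 := by
  simp [signedDegree, Y]

lemma signedDegree_v (n : ℤ) : signedDegree (v n) = 2 := by
  simp only [v, map_sub, map_add, map_smul, signedDegree_X, signedDegree_Y, smul_eq_mul]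
  ring

lemma signedDegree_nonpos {r : G} (hr : r ∈ R) (h : ¬(r = X 0 ∨ r = -Y 0)) :
    signedDegree r ≤ 0 := by
  push Not at h
  rcases hr with rfl | rfl | ⟨m, rfl⟩ | ⟨m, rfl⟩ | ⟨m, rfl⟩ | ⟨m, rfl⟩ | rfl | rfl |
    ⟨m, rfl⟩ | ⟨m, rfl⟩ | ⟨m, rfl⟩ | ⟨m, rfl⟩ <;> simp_all

lemma signedDegree_sum_le (L : List G) (hL : ∀ r ∈ L, r ∈ R) :
    signedDegree L.sum ≤ L.countP (fun r => decide (r = X 0 ∨ r = -Y 0)) := by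
  induction L with
  | nil => simp
  | cons r L ih =>
    have ihL := ih fun s hs => hL s (List.mem_cons_of_mem r hs)
    rw [List.sum_cons, map_add]
    by_cases h : r = X 0 ∨ r = -Y 0
    · rw [List.countP_cons_of_pos (by simpa using h)]
      have hr : signedDegree r = 1 := by rcases h with rfl | rfl <;> simp
      push_cast
      linarith
    · rw [List.countP_cons_of_neg (by simpa using h)]
      linarith [signedDegree_nonpos (hL r List.mem_cons_self) h]

/-- For every `n ≥ 1`, every presentation of `v n` as a sum of elements of `R`
(of any length) contains at least two terms equal to `X 0` or `−Y 0`
(counted with multiplicity). -/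
theorem at_least_two_writhe_terms (n : ℤ) (hn : 1 ≤ n)
    (L : List G) (hL : ∀ r ∈ L, r ∈ R) (hsum : L.sum = v n) :
    2 ≤ L.countP (fun r => decide (r = X 0 ∨ r = -Y 0)) := by
  have h := signedDegree_sum_le L hL
  rw [hsum, signedDegree_v] at h
  exact_mod_cast h
end
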